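/- arXiv:2411.14007 — 4 statements merged into one kernel-verified Lean document; each statement's English description precedes it below -/
import Mathlib

section
/- Let F be a set of n ≥ 1 firms and W a set of m ≥ 1 workers, where each firm i ∈ F has a subadditive valuation v_i : 2^W → ℝ≥0 and each worker j ∈ W has a value w_j(i) ≥ 0 for each firm i. Let μ be a many-to-one matching in which every worker is assigned to exactly one firm and every firm i receives a nonempty set μ_i of workers, and for each firm i let j_i ∈ μ_i be a worker maximizing v_i({j}) over j ∈ μ_i. Then NSW(μ) ≤ 1.33 · (∏_{i∈F} v_i({j_i}) · ∏_{j∈W} w_j(μ_j))^{1/(m+n)}. -/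
/-- A subadditive set function on a nonempty finite set is at most the sum of its values on
singletons. -/
theorem subadditive_le_sum_singleton {α : Type*} [DecidableEq α] {v : Finset α → ℝ}
    (hv : ∀ S T : Finset α, v (S ∪ T) ≤ v S + v T) {S : Finset α} (hS : S.Nonempty) :
    v S ≤ ∑ j ∈ S, v {j} := by
  induction hS using Finset.Nonempty.cons_induction with
  | singleton a => simp
  | cons a s ha hs ih =>
    rw [Finset.sum_cons, Finset.cons_eq_insert, Finset.insert_eq]
    exact (hv _ _).trans (by gcongr)

theorem natCast_le_pow_succ (k : ℕ) : (k : ℝ) ≤ 1.33 ^ (k + 1) := by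
  rcases lt_or_ge k 4 with hk | hk
  · interval_cases k <;> norm_num
  · induction k, hk using Nat.le_induction with
    | base => norm_num
    | succ k hk ih =>
      have hk' : (4 : ℝ) ≤ k := by exact_mod_cast hk
      rw [pow_succ]
      push_cast
      linarith

/-- Two-sided model: `F` firms (n ≥ 1), `W` workers (m ≥ 1), each firm `i` has a
nonnegative subadditive valuation `v i` over sets of workers, each worker `j` has a
nonnegative value `w j i` for firm `i`.  Let `μ : W → F` assign every worker to
exactly one firm so that every firm receives a nonempty set of workers, and for
each firm `i` let `ji i` be a worker assigned to `i` maximizing `v i {j}` over the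
workers `j` assigned to `i`.  Then
`NSW(μ) ≤ 1.33 * (∏ i v i {ji i} * ∏ j w j (μ j)) ^ (1/(m+n))`. -/
theorem nsw_le_of_favorite_worker {F W : Type*} [Fintype F] [Fintype W]
    [DecidableEq F] [DecidableEq W]
    (hF : 1 ≤ Fintype.card F) (hW : 1 ≤ Fintype.card W)
    (v : F → Finset W → ℝ) (hv0 : ∀ i S, 0 ≤ v i S)
    (hvsub : ∀ i (S T : Finset W), v i (S ∪ T) ≤ v i S + v i T)
    (w : W → F → ℝ) (hw0 : ∀ j i, 0 ≤ w j i)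
    (μ : W → F)
    (hne : ∀ i : F, (Finset.univ.filter fun j => μ j = i).Nonempty)
    (ji : F → W) (hji : ∀ i, μ (ji i) = i)
    (hjimax : ∀ i j, μ j = i → v i {j} ≤ v i {ji i}) :
    ((∏ i, v i (Finset.univ.filter fun j => μ j = i)) * ∏ j, w j (μ j)) ^
        ((1 : ℝ) / (Fintype.card W + Fintype.card F)) ≤
      1.33 * ((∏ i, v i {ji i}) * ∏ j, w j (μ j)) ^
        ((1 : ℝ) / (Fintype.card W + Fintype.card F)) := by
  have hk : ∀ i, v i (Finset.univ.filter fun j => μ j = i) ≤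
      1.33 ^ ((Finset.univ.filter fun j => μ j = i).card + 1) * v i {ji i} := fun i =>
    calc v i (Finset.univ.filter fun j => μ j = i)
        ≤ ∑ j ∈ Finset.univ.filter fun j => μ j = i, v i {j} :=
          subadditive_le_sum_singleton (hvsub i) (hne i)
      _ ≤ (Finset.univ.filter fun j => μ j = i).card • v i {ji i} :=
          Finset.sum_le_card_nsmul _ _ _ fun j hj => hjimax i j (Finset.mem_filter.1 hj).2
      _ ≤ _ := by
          rw [nsmul_eq_mul]
          exact mul_le_mul_of_nonneg_right (natCast_le_pow_succ _) (hv0 _ _)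
  have hcard : ∑ i, ((Finset.univ.filter fun j => μ j = i).card + 1) =
      Fintype.card W + Fintype.card F := by
    rw [Finset.sum_add_distrib, ← Finset.card_eq_sum_card_fiberwise (fun _ _ => by simp)]
    simp
  have hprod : ∏ i, v i (Finset.univ.filter fun j => μ j = i) ≤
      1.33 ^ (Fintype.card W + Fintype.card F) * ∏ i, v i {ji i} := by
    rw [← hcard, ← Finset.prod_pow_eq_pow_sum, ← Finset.prod_mul_distrib]
    exact Finset.prod_le_prod (fun i _ => hv0 _ _) fun i _ => hk i
  have hw : 0 ≤ ∏ j, w j (μ j) := Finset.prod_nonneg fun j _ => hw0 _ _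
  have hv : 0 ≤ ∏ i, v i {ji i} := Finset.prod_nonneg fun i _ => hv0 _ _
  have hv' : 0 ≤ ∏ i, v i (Finset.univ.filter fun j => μ j = i) :=
    Finset.prod_nonneg fun i _ => hv0 _ _
  have hroot : ((1.33 : ℝ) ^ (Fintype.card W + Fintype.card F)) ^
      ((1 : ℝ) / (Fintype.card W + Fintype.card F)) = 1.33 := by
    rw [one_div, ← Nat.cast_add]
    exact Real.pow_rpow_inv_natCast (by norm_num) (by omega)
  calc _ ≤ (1.33 ^ (Fintype.card W + Fintype.card F) *
        ((∏ i, v i {ji i}) * ∏ j, w j (μ j))) ^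
          ((1 : ℝ) / (Fintype.card W + Fintype.card F)) := by
        refine Real.rpow_le_rpow (mul_nonneg hv' hw) ?_ (by positivity)
        rw [← mul_assoc]
        exact mul_le_mul_of_nonneg_right hprod hw
    _ = _ := by rw [Real.mul_rpow (by positivity) (mul_nonneg hv hw), hroot]
end

section
/- There exists a normalized, monotone, submodular set function v on the 4-element set M = {w_1, w_2, w_3, w_4} whose capped function v'(S) := max_{S' ⊆ S, |S'| ≤ 2} v(S') is not submodular. Specifically, define v(∅) = 0, v({w_2, w_4}) = 4, v({w_1, w_3, w_4}) = 3, and v(S) = min(4, |S| + 1) for all other S ⊆ M. Then v is normalized, monotone, and submodular, while v' satisfies v'({w_1, w_3} ∪ {w_4}) − v'({w_1, w_3}) = 0 < 1 = v'({w_1, w_2, w_3} ∪ {w_4}) − v'({w_1, w_2, w_3}); hence v' is not submodular. -/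
/-- The explicit submodular valuation of the counterexample, on the four-element
set `M = {w₁, w₂, w₃, w₄}` (encoded as `Fin 4`, with `wᵢ` encoded as `i - 1`):
`v ∅ = 0`, `v {w₂, w₄} = 4`, `v {w₁, w₃, w₄} = 3`, and
`v S = min 4 (|S| + 1)` for all other `S`. -/
noncomputable def exampleV : Finset (Fin 4) → ℝ := fun S =>
  if S = ∅ then 0
  else if S = {1, 3} then 4
  else if S = {0, 2, 3} then 3
  else min 4 ((S.card : ℝ) + 1)

/-- The capped function of `v` with capacity `2`:
`v' S = max_{S' ⊆ S, |S'| ≤ 2} v S'`. -/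
noncomputable def cappedExampleV (S : Finset (Fin 4)) : ℝ :=
  (S.powerset.filter fun T => T.card ≤ 2).sup'
    ⟨∅, by simp⟩ exampleV

/-- The natural-number valued form of `exampleV`, on which statements are decidable. -/
def exampleNat (S : Finset (Fin 4)) : ℕ :=
  if S = ∅ then 0
  else if S = {1, 3} then 4
  else if S = {0, 2, 3} then 3
  else min 4 (S.card + 1)

/-- The natural-number valued form of `cappedExampleV`. -/
def cappedExampleNat (S : Finset (Fin 4)) : ℕ :=
  (S.powerset.filter fun T => T.card ≤ 2).sup' ⟨∅, by simp⟩ exampleNat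

theorem exampleV_eq_natCast (S : Finset (Fin 4)) : exampleV S = (exampleNat S : ℝ) := by
  unfold exampleV exampleNat
  split_ifs <;> simp

theorem cappedExampleV_eq_natCast (S : Finset (Fin 4)) :
    cappedExampleV S = (cappedExampleNat S : ℝ) := by
  refine Eq.trans (Finset.sup'_congr _ rfl fun T _ => exampleV_eq_natCast T) ?_
  exact (Finset.apply_sup'_eq_sup'_comp _ (Nat.cast : ℕ → ℝ) fun x y => Nat.cast_max x y).symm

theorem exampleNat_mono : ∀ S T : Finset (Fin 4), S ⊆ T → exampleNat S ≤ exampleNat T := by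
  decide +kernel

theorem exampleNat_submodular : ∀ S T : Finset (Fin 4), S ⊆ T → ∀ j ∉ T,
    exampleNat (insert j T) + exampleNat S ≤ exampleNat (insert j S) + exampleNat T := by
  decide +kernel

theorem cappedExampleNat_pair : cappedExampleNat {0, 2} = 3 := by decide +kernel

theorem cappedExampleNat_pair_union : cappedExampleNat ({0, 2} ∪ {3}) = 3 := by decide +kernel

theorem cappedExampleNat_triple : cappedExampleNat {0, 1, 2} = 3 := by decide +kernel

theorem cappedExampleNat_triple_union : cappedExampleNat ({0, 1, 2} ∪ {3}) = 4 := by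
  decide +kernel

/-- There is a normalized, monotone, submodular set function on a 4-element set
whose capped function with capacity `2` is not submodular: the explicit function
`exampleV` is normalized, monotone and submodular, while its capped function
`v'` has marginal `0` when adding `w₄` to `{w₁, w₃}` but marginal `1` when
adding `w₄` to the larger set `{w₁, w₂, w₃}`; hence `v'` is not submodular. -/
theorem capped_not_submodular :
    exampleV ∅ = 0 ∧
    (∀ S, 0 ≤ exampleV S) ∧
    (∀ S T : Finset (Fin 4), S ⊆ T → exampleV S ≤ exampleV T) ∧
    (∀ S T : Finset (Fin 4), S ⊆ T → ∀ j ∉ T,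
      exampleV (insert j T) - exampleV T ≤ exampleV (insert j S) - exampleV S) ∧
    cappedExampleV ({0, 2} ∪ {3}) - cappedExampleV {0, 2} = 0 ∧
    cappedExampleV ({0, 1, 2} ∪ {3}) - cappedExampleV {0, 1, 2} = 1 ∧
    ¬ (∀ S T : Finset (Fin 4), S ⊆ T → ∀ j ∉ T,
      cappedExampleV (insert j T) - cappedExampleV T ≤
        cappedExampleV (insert j S) - cappedExampleV S) := by
  have h_pair : cappedExampleV ({0, 2} ∪ {3}) - cappedExampleV {0, 2} = 0 := by
    simp only [cappedExampleV_eq_natCast, cappedExampleNat_pair, cappedExampleNat_pair_union]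
    norm_num
  have h_triple : cappedExampleV ({0, 1, 2} ∪ {3}) - cappedExampleV {0, 1, 2} = 1 := by
    simp only [cappedExampleV_eq_natCast, cappedExampleNat_triple, cappedExampleNat_triple_union]
    norm_num
  refine ⟨by simp [exampleV], fun S => ?_, fun S T hST => ?_, fun S T hST j hj => ?_,
    h_pair, h_triple, fun h => ?_⟩
  · rw [exampleV_eq_natCast]
    positivity
  · rw [exampleV_eq_natCast, exampleV_eq_natCast]
    exact_mod_cast exampleNat_mono S T hST
  · have h : (exampleNat (insert j T) + exampleNat S : ℝ) ≤
        exampleNat (insert j S) + exampleNat T := by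
      exact_mod_cast exampleNat_submodular S T hST j hj
    simp only [exampleV_eq_natCast]
    linarith
  · have h_marginal := h {0, 2} {0, 1, 2} (by decide) 3 (by decide)
    rw [show insert 3 ({0, 1, 2} : Finset (Fin 4)) = {0, 1, 2} ∪ {3} by decide,
      show insert 3 ({0, 2} : Finset (Fin 4)) = {0, 2} ∪ {3} by decide] at h_marginal
    linarith
end

section
/- For every real number ε with 0 < ε < 0.33 and every real number x with x ≥ 1/ε², x^{1/(1+x)} < 1 + ε. -/
theorem log_le_two_fifths_mul {s : ℝ} (hs : 0 < s) : Real.log s ≤ 2 / 5 * s := by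
  have he := Real.exp_one_gt_d9
  have h := Real.log_le_sub_one_of_pos (div_pos hs (Real.exp_pos 1))
  rw [Real.log_div hs.ne' (Real.exp_pos 1).ne', Real.log_exp] at h
  have h' : s / Real.exp 1 ≤ 2 / 5 * s := by
    rw [div_le_iff₀ (Real.exp_pos 1)]
    nlinarith
  linarith

/-- For every real `ε` with `0 < ε < 0.33` and every real `x ≥ 1/ε²`,
`x ^ (1/(1+x)) < 1 + ε`. -/
theorem rpow_lt_one_add_of_ge_inv_sq (ε x : ℝ) (hε0 : 0 < ε) (hε1 : ε < 0.33)
    (hx : 1 / ε ^ 2 ≤ x) :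
    x ^ ((1 : ℝ) / (1 + x)) < 1 + ε := by
  have hx0 : 0 < x := lt_of_lt_of_le (by positivity) hx
  obtain ⟨s, hs, rfl⟩ : ∃ s : ℝ, 0 < s ∧ s ^ 2 = x :=
    ⟨√x, Real.sqrt_pos.2 hx0, Real.sq_sqrt hx0.le⟩
  have hsε : 1 / s ≤ ε := by
    rw [← one_div_pow, sq_le_sq₀ (by positivity) hs.le] at hx
    exact (one_div_le hε0 hs).1 hx
  have hlog : 2 / (1 + 2 * s) ≤ Real.log (1 + ε) := calc
    2 / (1 + 2 * s) = 2 * (1 / s) / (1 / s + 2) := by field_simp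
    _ ≤ Real.log (1 + 1 / s) := Real.le_log_one_add_of_nonneg (by positivity)
    _ ≤ Real.log (1 + ε) := Real.log_le_log (by positivity) (by linarith)
  have hkey : 2 * (2 / 5 * s) < 2 / (1 + 2 * s) * (1 + s ^ 2) := by
    rw [div_mul_eq_mul_div 2 (1 + 2 * s), lt_div_iff₀ (by positivity)]
    nlinarith [sq_nonneg (s - 1)]
  rw [Real.rpow_def_of_pos hx0, ← Real.lt_log_iff_exp_lt (by linarith), mul_one_div,
    div_lt_iff₀ (by positivity), Real.log_pow]
  calc (2 : ℕ) * Real.log s ≤ 2 * (2 / 5 * s) := by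
        push_cast
        linarith [log_le_two_fifths_mul hs]
    _ < 2 / (1 + 2 * s) * (1 + s ^ 2) := hkey
    _ ≤ Real.log (1 + ε) * (1 + s ^ 2) := by gcongr
end

section
/- For every real number x > 0, min(x^{1/(x+1)}, e^{1/(e(x+1))}) ≤ e^{1/(e(e^{1/e}+1))}; that is, the function x ↦ min(x^{1/(x+1)}, e^{1/(e(x+1))}) attains its maximum over (0, ∞) at x = e^{1/e}. -/
/-- On `(0, a]` the function `x ↦ log x / (x + 1)` is bounded by its value at `a`,
provided `log a ≤ 1`. -/
theorem log_div_add_one_le_of_le {x a c : ℝ} (hx : 0 < x) (hxa : x ≤ a)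
    (hc : Real.log a = c) (hc1 : c ≤ 1) :
    Real.log x / (x + 1) ≤ c / (a + 1) := by
  have ha : 0 < a := hx.trans_le hxa
  have hlog : Real.log x ≤ c - (a - x) / a := by
    have h := Real.log_le_sub_one_of_pos (div_pos hx ha)
    rw [Real.log_div hx.ne' ha.ne', hc] at h
    rw [sub_div, div_self ha.ne']
    linarith
  rw [div_le_div_iff₀ (by linarith) (by linarith)]
  have hq : 0 ≤ (a - x) / a := div_nonneg (sub_nonneg.2 hxa) ha.le
  have hqa : (a - x) / a * a = a - x := div_mul_cancel₀ _ ha.ne'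
  have hmul : Real.log x * (a + 1) ≤ (c - (a - x) / a) * (a + 1) :=
    mul_le_mul_of_nonneg_right hlog (by linarith)
  have hca : c * (a - x) ≤ 1 * (a - x) :=
    mul_le_mul_of_nonneg_right hc1 (sub_nonneg.2 hxa)
  linarith

/-- For every `x > 0`, `min (x^{1/(x+1)}, e^{1/(e(x+1))}) ≤ e^{1/(e(e^{1/e}+1))}`;
moreover the maximum is attained at `x = e^{1/e}`. -/
theorem min_rpow_exp_le :
    (∀ x : ℝ, 0 < x →
      min (x ^ ((1 : ℝ) / (x + 1))) (Real.exp (1 / (Real.exp 1 * (x + 1)))) ≤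
        Real.exp (1 / (Real.exp 1 * (Real.exp (1 / Real.exp 1) + 1)))) ∧
    min ((Real.exp (1 / Real.exp 1)) ^ ((1 : ℝ) / (Real.exp (1 / Real.exp 1) + 1)))
        (Real.exp (1 / (Real.exp 1 * (Real.exp (1 / Real.exp 1) + 1)))) =
      Real.exp (1 / (Real.exp 1 * (Real.exp (1 / Real.exp 1) + 1))) := by
  have he : 0 < Real.exp 1 := Real.exp_pos 1
  have ha : 0 < Real.exp (1 / Real.exp 1) := Real.exp_pos _
  refine ⟨fun x hx => ?_, ?_⟩
  · rcases le_total x (Real.exp (1 / Real.exp 1)) with h | h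
    · refine (min_le_left _ _).trans ?_
      rw [Real.rpow_def_of_pos hx, Real.exp_le_exp, mul_one_div, ← div_div]
      apply log_div_add_one_le_of_le hx h (Real.log_exp _)
      rw [div_le_one he]
      exact Real.one_le_exp zero_le_one
    · refine (min_le_right _ _).trans ?_
      gcongr
  · rw [Real.rpow_def_of_pos ha, Real.log_exp, one_div_mul_one_div, min_self]
end
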